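/- Let p > 1, let d be a positive integer, s ∈ ℝ, and set σ_p = (∫_ℝ exp(−|x|^p) dx)^{−1}, π(x) = σ_p exp(−|x|^p). Let ρ_ℓ be the Borel probability measure on ℝ which is the law of ℓ^{−s/d−1/2+1/p} X_ℓ where X_ℓ has density π, and let λ = ⊗_{ℓ=1}^∞ ρ_ℓ be the infinite product probability measure on ℝ^ℕ with the product σ-algebra. Then λ is Fomin differentiable along h = (h_ℓ) ∈ ℝ^ℕ if and only if Σ_{ℓ=1}^∞ ℓ^{2s/d + 1 − 2/p} h_ℓ² < ∞. -/

import Mathlib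

open MeasureTheory Filter Topology
open scoped ENNReal

/-- `r u` is the density of the translate `B ↦ P (B + u)` with respect to `P`. -/
structure IsShiftDensity (P : Measure ℝ) (r : ℝ → ℝ → ℝ) : Prop where
  measurable : ∀ u, Measurable (r u)
  nonneg : ∀ u x, 0 ≤ r u x
  zero : ∀ x, r 0 x = 1
  map_sub : ∀ u, P.map (fun x => x - u) = P.withDensity fun x => ENNReal.ofReal (r u x)

lemma tendsto_prod_of_le_one_sub {a : ℝ → ℝ} {c : ℝ} (hc : 0 < c) (ha : ∀ u, 0 ≤ a u)
    (ha' : ∀ u, a u ≤ 1 - c * min |u| 1 ^ 2) {g : ℕ → ℝ} (hg : ¬ Summable fun i => g i ^ 2) :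
    Tendsto (fun n => ∏ i ∈ Finset.range n, a (g i)) atTop (𝓝 0) := by
  have hns : ¬ Summable fun i => c * min |g i| 1 ^ 2 := by
    intro hs
    rw [summable_mul_left_iff hc.ne'] at hs
    apply hg
    have hev : ∀ᶠ i in atTop, min |g i| 1 ^ 2 < 1 :=
      hs.tendsto_atTop_zero.eventually (gt_mem_nhds one_pos)
    refine hs.congr_atTop (hev.mono fun i hi => ?_)
    rcases le_total |g i| 1 with h | h
    · simp only [min_eq_left h, sq_abs]
    · rw [min_eq_right h] at hi
      norm_num at hi
  rw [not_summable_iff_tendsto_nat_atTop_of_nonneg fun i => by positivity] at hns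
  refine squeeze_zero (fun n => Finset.prod_nonneg fun i _ => ha _) (fun n => ?_)
    (Real.tendsto_exp_neg_atTop_nhds_zero.comp hns)
  rw [Function.comp_apply, ← Finset.sum_neg_distrib, Real.exp_sum]
  refine Finset.prod_le_prod (fun i _ => ha _) fun i _ => ?_
  refine (ha' (g i)).trans ?_
  have := Real.add_one_le_exp (-(c * min |g i| 1 ^ 2))
  linarith

section Product

variable {P : Measure ℝ}

variable (P) in
/-- The measure `A ↦ ν (A + g)` where `ν` is the countable power of `P`. -/
noncomputable def powerShift (g : ℕ → ℝ) : Measure (ℕ → ℝ) :=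
  (Measure.infinitePi fun _ : ℕ => P).map fun x => x - g

lemma powerShift_apply (g : ℕ → ℝ) {A : Set (ℕ → ℝ)} (hA : MeasurableSet A) :
    powerShift P g A = Measure.infinitePi (fun _ : ℕ => P) ((fun x => x - g) ⁻¹' A) :=
  Measure.map_apply (by fun_prop) hA

lemma powerShift_zero : powerShift P 0 = Measure.infinitePi fun _ : ℕ => P := by
  simp [powerShift]

/-- Restriction of a sequence to its first `n` coordinates. -/
def truncateSeq (n : ℕ) (g : ℕ → ℝ) (i : ℕ) : ℝ := if i < n then g i else 0

lemma powerShift_congr {g g' : ℕ → ℝ} {n : ℕ} (hg : ∀ i < n, g i = g' i) {A : Set (ℕ → ℝ)}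
    (hA : MeasurableSet A) (hdep : ∀ x y : ℕ → ℝ, (∀ i < n, x i = y i) → (x ∈ A ↔ y ∈ A)) :
    powerShift P g A = powerShift P g' A := by
  rw [powerShift_apply g hA, powerShift_apply g' hA]
  congr 1
  ext x
  exact hdep _ _ fun i hi => by simp [hg i hi]

lemma powerShift_add_apply (a b : ℕ → ℝ) {A : Set (ℕ → ℝ)} (hA : MeasurableSet A) :
    powerShift P (a + b) A = powerShift P b ((fun x => x - a) ⁻¹' A) := by
  have hm : MeasurableSet ((fun x : ℕ → ℝ => x - a) ⁻¹' A) :=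
    (show Measurable fun x : ℕ → ℝ => x - a by fun_prop) hA
  rw [powerShift_apply _ hA, powerShift_apply _ hm, ← Set.preimage_comp]
  congr 2
  ext x i
  simp
  ring

variable [IsProbabilityMeasure P]

lemma lintegral_infinitePi_prod (s : Finset ℕ) {f : ℕ → ℝ → ℝ≥0∞} (hf : ∀ i, Measurable (f i)) :
    ∫⁻ x, ∏ i ∈ s, f i (x i) ∂(Measure.infinitePi fun _ : ℕ => P) = ∏ i ∈ s, ∫⁻ y, f i y ∂P := by
  refine (ProbabilityTheory.lintegral_prod_eq_prod_lintegral_of_indepFun s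
    (fun i (x : ℕ → ℝ) => f i (x i))
    (ProbabilityTheory.iIndepFun_infinitePi hf)
    (fun i => (hf i).comp (measurable_pi_apply i))).trans ?_
  refine Finset.prod_congr rfl fun i _ => ?_
  exact (measurePreserving_eval_infinitePi (fun _ : ℕ => P) i).lintegral_comp (hf i)

lemma integral_infinitePi_prod (s : Finset ℕ) {f : ℕ → ℝ → ℝ} (hf : ∀ i, Measurable (f i))
    (h0 : ∀ i y, 0 ≤ f i y) :
    ∫ x, ∏ i ∈ s, f i (x i) ∂(Measure.infinitePi fun _ : ℕ => P) = ∏ i ∈ s, ∫ y, f i y ∂P := by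
  have hm : Measurable fun x : ℕ → ℝ => ∏ i ∈ s, f i (x i) :=
    Finset.measurable_prod s fun i _ => (hf i).comp (measurable_pi_apply i)
  rw [integral_eq_lintegral_of_nonneg_ae
    (ae_of_all _ fun x => Finset.prod_nonneg fun i _ => h0 i (x i)) hm.aestronglyMeasurable]
  simp_rw [ENNReal.ofReal_prod_of_nonneg fun i (_ : i ∈ s) => h0 i _]
  rw [lintegral_infinitePi_prod s (fun i => (hf i).ennreal_ofReal), ENNReal.toReal_prod]
  refine Finset.prod_congr rfl fun i _ => ?_
  rw [integral_eq_lintegral_of_nonneg_ae (ae_of_all _ (h0 i)) (hf i).aestronglyMeasurable]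

lemma integrable_infinitePi_prod (s : Finset ℕ) {f : ℕ → ℝ → ℝ} (hf : ∀ i, Measurable (f i))
    (h0 : ∀ i y, 0 ≤ f i y) (hint : ∀ i, Integrable (f i) P) :
    Integrable (fun x => ∏ i ∈ s, f i (x i)) (Measure.infinitePi fun _ : ℕ => P) := by
  have hm : Measurable fun x : ℕ → ℝ => ∏ i ∈ s, f i (x i) :=
    Finset.measurable_prod s fun i _ => (hf i).comp (measurable_pi_apply i)
  refine ⟨hm.aestronglyMeasurable, ?_⟩
  rw [hasFiniteIntegral_iff_ofReal
    (ae_of_all _ fun x => Finset.prod_nonneg fun i _ => h0 i (x i))]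
  simp_rw [ENNReal.ofReal_prod_of_nonneg fun i (_ : i ∈ s) => h0 i _]
  rw [lintegral_infinitePi_prod s (fun i => (hf i).ennreal_ofReal)]
  refine ENNReal.prod_lt_top fun i _ => ?_
  exact (hasFiniteIntegral_iff_ofReal (ae_of_all _ (h0 i))).1 (hint i).2

instance (g : ℕ → ℝ) : IsProbabilityMeasure (powerShift P g) :=
  Measure.isProbabilityMeasure_map (by fun_prop)

variable {r : ℝ → ℝ → ℝ}

lemma IsShiftDensity.integrable (hr : IsShiftDensity P r) (u : ℝ) : Integrable (r u) P := by
  refine ⟨(hr.measurable u).aestronglyMeasurable, ?_⟩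
  rw [hasFiniteIntegral_iff_ofReal (ae_of_all _ (hr.nonneg u))]
  have : IsProbabilityMeasure (P.map fun x => x - u) :=
    Measure.isProbabilityMeasure_map (by fun_prop)
  rw [← setLIntegral_univ, ← withDensity_apply _ .univ, ← hr.map_sub u, measure_univ]
  exact ENNReal.one_lt_top

lemma IsShiftDensity.integral_eq_one (hr : IsShiftDensity P r) (u : ℝ) : ∫ x, r u x ∂P = 1 := by
  rw [integral_eq_lintegral_of_nonneg_ae (ae_of_all _ (hr.nonneg u))
    (hr.measurable u).aestronglyMeasurable]
  have : IsProbabilityMeasure (P.map fun x => x - u) :=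
    Measure.isProbabilityMeasure_map (by fun_prop)
  rw [← setLIntegral_univ, ← withDensity_apply _ .univ, ← hr.map_sub u, measure_univ]
  simp

lemma IsShiftDensity.integrable_sqrt (hr : IsShiftDensity P r) (u : ℝ) :
    Integrable (fun x => √(r u x)) P := by
  refine ((hr.integrable u).add (integrable_const 1)).mono'
    (hr.measurable u).sqrt.aestronglyMeasurable (ae_of_all _ fun x => ?_)
  rw [Real.norm_of_nonneg (Real.sqrt_nonneg _)]
  have h := Real.sq_sqrt (hr.nonneg u x)
  simp only [Pi.add_apply]
  nlinarith [sq_nonneg (√(r u x) - 1), Real.sqrt_nonneg (r u x)]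

lemma IsShiftDensity.powerShift_eq (hr : IsShiftDensity P r) {n : ℕ} {g : ℕ → ℝ}
    (hg : ∀ i, n ≤ i → g i = 0) :
    powerShift P g = (Measure.infinitePi fun _ : ℕ => P).withDensity
      fun x => ENNReal.ofReal (∏ i ∈ Finset.range n, r (g i) (x i)) := by
  have hpr (i : ℕ) : IsProbabilityMeasure (P.map fun x => x - g i) :=
    Measure.isProbabilityMeasure_map (by fun_prop)
  have h1 : powerShift P g = Measure.infinitePi fun i => P.map fun x => x - g i :=
    Measure.infinitePi_map_pi (fun _ : ℕ => P) (f := fun i x => x - g i) (by fun_prop)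
  rw [h1]
  symm
  refine Measure.eq_infinitePi _ fun s t ht => ?_
  have hmt : MeasurableSet (Set.pi (s : Set ℕ) t) := .pi s.countable_toSet fun i _ => ht i
  rw [withDensity_apply _ hmt, ← lintegral_indicator hmt]
  set S := Finset.range n ∪ s
  let f : ℕ → ℝ → ℝ≥0∞ := fun i =>
    (if i ∈ s then t i else Set.univ).indicator fun y => ENNReal.ofReal (r (g i) y)
  have hmi (i : ℕ) : MeasurableSet (if i ∈ s then t i else Set.univ) := by
    split_ifs
    exacts [ht i, .univ]
  have hf (i : ℕ) : Measurable (f i) :=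
    (hr.measurable (g i)).ennreal_ofReal.indicator (hmi i)
  have hfS (x : ℕ → ℝ) : (Set.pi (s : Set ℕ) t).indicator
      (fun x => ENNReal.ofReal (∏ i ∈ Finset.range n, r (g i) (x i))) x
      = ∏ i ∈ S, f i (x i) := by
    by_cases hx : x ∈ Set.pi (s : Set ℕ) t
    · rw [Set.indicator_of_mem hx, ENNReal.ofReal_prod_of_nonneg fun i _ => hr.nonneg _ _]
      have h2 (i : ℕ) : f i (x i) = ENNReal.ofReal (r (g i) (x i)) := by
        refine Set.indicator_of_mem ?_ _
        split_ifs with hi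
        exacts [hx i hi, trivial]
      simp_rw [h2]
      refine Finset.prod_subset Finset.subset_union_left fun i _ hi => ?_
      rw [hg i (by simpa using hi), hr.zero, ENNReal.ofReal_one]
    · rw [Set.indicator_of_notMem hx]
      obtain ⟨i, hi, hxi⟩ : ∃ i ∈ s, x i ∉ t i := by simpa [Set.mem_pi] using hx
      refine (Finset.prod_eq_zero (Finset.mem_union_right _ hi) ?_).symm
      simp [f, hi, hxi]
  simp_rw [hfS]
  rw [lintegral_infinitePi_prod S hf]
  have h3 (i : ℕ) : ∫⁻ y, f i y ∂P
      = (P.map fun x => x - g i) (if i ∈ s then t i else Set.univ) := by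
    rw [hr.map_sub, withDensity_apply _ (hmi i), lintegral_indicator (hmi i)]
  simp_rw [h3]
  rw [← Finset.prod_subset (Finset.subset_union_right : s ⊆ S)]
  · exact Finset.prod_congr rfl fun i hi => by rw [if_pos hi]
  · intro i _ hi
    rw [if_neg hi, measure_univ]

lemma IsShiftDensity.integrable_prod (hr : IsShiftDensity P r) (n : ℕ) (g : ℕ → ℝ) :
    Integrable (fun x => ∏ i ∈ Finset.range n, r (g i) (x i))
      (Measure.infinitePi fun _ : ℕ => P) :=
  integrable_infinitePi_prod _ (fun i => hr.measurable (g i)) (fun i => hr.nonneg (g i))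
    fun i => hr.integrable (g i)

lemma IsShiftDensity.powerShift_real (hr : IsShiftDensity P r) {n : ℕ} {g : ℕ → ℝ}
    (hg : ∀ i, n ≤ i → g i = 0) {A : Set (ℕ → ℝ)} (hA : MeasurableSet A) :
    (powerShift P g).real A =
      ∫ x in A, ∏ i ∈ Finset.range n, r (g i) (x i) ∂(Measure.infinitePi fun _ : ℕ => P) := by
  have h0 (x : ℕ → ℝ) : 0 ≤ ∏ i ∈ Finset.range n, r (g i) (x i) :=
    Finset.prod_nonneg fun i _ => hr.nonneg _ _
  rw [measureReal_def, hr.powerShift_eq hg, withDensity_apply _ hA,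
    integral_eq_lintegral_of_nonneg_ae (ae_of_all _ h0)
      (hr.integrable_prod n g).aestronglyMeasurable.restrict]

lemma one_sub_sum_le_prod {a b : ℕ → ℝ} (h0 : ∀ i, 0 ≤ a i) (h1 : ∀ i, a i ≤ 1)
    (hb : ∀ i, 1 - b i ≤ a i) (n : ℕ) :
    1 - ∑ i ∈ Finset.range n, b i ≤ ∏ i ∈ Finset.range n, a i := by
  induction n with
  | zero => simp
  | succ n ih =>
    rw [Finset.sum_range_succ, Finset.prod_range_succ]
    have hp1 : ∏ i ∈ Finset.range n, a i ≤ 1 := Finset.prod_le_one (fun i _ => h0 i) fun i _ => h1 i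
    nlinarith [hb n, h0 n, h1 n]

lemma IsShiftDensity.affinity_le_one (hr : IsShiftDensity P r) (u : ℝ) :
    ∫ x, √(r u x) ∂P ≤ 1 := by
  have h : ∫ x, √(r u x) ∂P ≤ ∫ x, (r u x + 1) / 2 ∂P := by
    refine integral_mono (hr.integrable_sqrt u)
      (((hr.integrable u).add (integrable_const 1)).div_const 2) fun x => ?_
    have h := Real.sq_sqrt (hr.nonneg u x)
    nlinarith [sq_nonneg (√(r u x) - 1)]
  rw [integral_div, integral_add (hr.integrable u) (integrable_const 1), hr.integral_eq_one] at h
  simpa using h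

lemma IsShiftDensity.abs_powerShift_sub_le (hr : IsShiftDensity P r) {C : ℝ}
    (hC : ∀ u, 1 - C * u ^ 2 ≤ ∫ x, √(r u x) ∂P) {n : ℕ} {g : ℕ → ℝ}
    (hg : ∀ i, n ≤ i → g i = 0) {K : ℝ} (hK : 0 < K)
    (hgK : ∑ i ∈ Finset.range n, g i ^ 2 ≤ K ^ 2)
    {A : Set (ℕ → ℝ)} (hA : MeasurableSet A) :
    |(powerShift P g).real A - (Measure.infinitePi fun _ : ℕ => P).real A| ≤ (|C| + 2) * K := by
  set ν := Measure.infinitePi fun _ : ℕ => P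
  set F : (ℕ → ℝ) → ℝ := fun x => ∏ i ∈ Finset.range n, r (g i) (x i) with hF
  set G : (ℕ → ℝ) → ℝ := fun x => ∏ i ∈ Finset.range n, √(r (g i) (x i)) with hG
  have hF0 : ∀ x, 0 ≤ F x := fun x => Finset.prod_nonneg fun i _ => hr.nonneg _ _
  have hFint : Integrable F ν := hr.integrable_prod n g
  have hGint : Integrable G ν := integrable_infinitePi_prod (Finset.range n)
    (f := fun i y => √(r (g i) y)) (fun i => (hr.measurable (g i)).sqrt)
    (fun i y => Real.sqrt_nonneg _) (fun i => hr.integrable_sqrt (g i))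
  have hFG : ∀ x, G x ^ 2 = F x := fun x => by
    simp only [hG, hF, ← Finset.prod_pow]
    exact Finset.prod_congr rfl fun i _ => Real.sq_sqrt (hr.nonneg _ _)
  have hG0 : ∀ x, 0 ≤ G x := fun x => Finset.prod_nonneg fun i _ => Real.sqrt_nonneg _
  have hFone : ∫ x, F x ∂ν = 1 := by
    rw [integral_infinitePi_prod (Finset.range n) (f := fun i y => r (g i) y)
      (fun i => hr.measurable (g i)) (fun i => hr.nonneg (g i))]
    exact Finset.prod_eq_one fun i _ => hr.integral_eq_one (g i)
  have hGval : ∫ x, G x ∂ν = ∏ i ∈ Finset.range n, ∫ y, √(r (g i) y) ∂P :=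
    integral_infinitePi_prod (Finset.range n) (f := fun i y => √(r (g i) y))
      (fun i => (hr.measurable (g i)).sqrt) (fun i y => Real.sqrt_nonneg _)
  have hGle : ∫ x, G x ∂ν ≤ 1 := by
    rw [hGval]
    exact Finset.prod_le_one (fun i _ => integral_nonneg fun _ => Real.sqrt_nonneg _)
      fun i _ => hr.affinity_le_one (g i)
  have hGge : 1 - |C| * K ^ 2 ≤ ∫ x, G x ∂ν := by
    rw [hGval]
    refine le_trans ?_ (one_sub_sum_le_prod (b := fun i => |C| * g i ^ 2)
      (fun i => integral_nonneg fun _ => Real.sqrt_nonneg _)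
      (fun i => hr.affinity_le_one (g i)) (fun i => ?_) n)
    · rw [← Finset.mul_sum]
      gcongr
    · refine le_trans ?_ (hC (g i))
      gcongr
      exact le_abs_self C
  rw [hr.powerShift_real hg hA]
  have h1 : ν.real A = ∫ x in A, (1 : ℝ) ∂ν := by simp
  rw [h1, ← integral_sub hFint.integrableOn (integrable_const 1)]
  have hbound : ∀ x, |F x - 1| ≤ (F x + 1 - 2 * G x) / (2 * K) + K * (F x + 1 + 2 * G x) / 2 := by
    intro x
    have hx := hFG x
    have e1 : |F x - 1| = |G x - 1| * (G x + 1) := by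
      rw [← hx, show G x ^ 2 - 1 = (G x - 1) * (G x + 1) by ring, abs_mul,
        abs_of_nonneg (add_nonneg (hG0 x) zero_le_one)]
    have e2 : F x + 1 - 2 * G x = |G x - 1| ^ 2 := by rw [sq_abs, ← hx]; ring
    have e3 : F x + 1 + 2 * G x = (G x + 1) ^ 2 := by rw [← hx]; ring
    rw [e1, e2, e3]
    have : |G x - 1| ^ 2 / (2 * K) + K * (G x + 1) ^ 2 / 2 - |G x - 1| * (G x + 1)
        = (|G x - 1| - K * (G x + 1)) ^ 2 / (2 * K) := by field_simp; ring
    have h2 : 0 ≤ (|G x - 1| - K * (G x + 1)) ^ 2 / (2 * K) := by positivity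
    linarith
  have hF1 : Integrable (fun x => F x + 1) ν := hFint.add (integrable_const 1)
  have hint1 : Integrable (fun x => F x + 1 - 2 * G x) ν :=
    hF1.sub (hGint.const_mul 2)
  have hint2 : Integrable (fun x => F x + 1 + 2 * G x) ν :=
    hF1.add (hGint.const_mul 2)
  have hv1 : ∫ x, (F x + 1 - 2 * G x) ∂ν = 2 - 2 * ∫ x, G x ∂ν := by
    rw [integral_sub hF1 (hGint.const_mul 2),
      integral_add hFint (integrable_const 1), hFone, integral_const_mul]
    simp; norm_num
  have hv2 : ∫ x, (F x + 1 + 2 * G x) ∂ν = 2 + 2 * ∫ x, G x ∂ν := by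
    rw [integral_add hF1 (hGint.const_mul 2),
      integral_add hFint (integrable_const 1), hFone, integral_const_mul]
    simp; norm_num
  calc |∫ x in A, (F x - 1) ∂ν| ≤ ∫ x in A, |F x - 1| ∂ν := abs_integral_le_integral_abs
    _ ≤ ∫ x, |F x - 1| ∂ν := setIntegral_le_integral (hFint.sub (integrable_const 1)).abs
        (ae_of_all _ fun x => abs_nonneg _)
    _ ≤ ∫ x, ((F x + 1 - 2 * G x) / (2 * K) + K * (F x + 1 + 2 * G x) / 2) ∂ν :=
        integral_mono (hFint.sub (integrable_const 1)).abs
          ((hint1.div_const _).add ((hint2.const_mul K).div_const 2)) hbound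
    _ = (2 - 2 * ∫ x, G x ∂ν) / (2 * K) + K * (2 + 2 * ∫ x, G x ∂ν) / 2 := by
        rw [integral_add (hint1.div_const _) ((hint2.const_mul K).div_const 2), integral_div,
          integral_div, integral_const_mul, hv1, hv2]
    _ ≤ (2 * (|C| * K ^ 2)) / (2 * K) + K * (2 + 2 * 1) / 2 := by
        gcongr
        linarith
    _ = (|C| + 2) * K := by field_simp; ring


open scoped symmDiff in
lemma IsShiftDensity.abs_powerShift_sub_le_of_forall_sum_le (hr : IsShiftDensity P r) {C : ℝ}
    (hC : ∀ u, 1 - C * u ^ 2 ≤ ∫ x, √(r u x) ∂P) {g : ℕ → ℝ} {K : ℝ} (hK : 0 < K)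
    (hgK : ∀ n, ∑ i ∈ Finset.range n, g i ^ 2 ≤ K ^ 2)
    {A : Set (ℕ → ℝ)} (hA : MeasurableSet A) :
    |(powerShift P g).real A - (Measure.infinitePi fun _ : ℕ => P).real A| ≤ (|C| + 2) * K := by
  set ν := Measure.infinitePi fun _ : ℕ => P
  refine le_of_forall_pos_le_add fun ε hε => ?_
  obtain ⟨B, hB, hAB⟩ := (Measure.MeasureDense.of_generateFrom_isSetAlgebra_finite
    (ν + powerShift P g) isSetAlgebra_measurableCylinders
    generateFrom_measurableCylinders.symm).approx A hA (measure_ne_top _ _) (ε / 2) (by positivity)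
  have hBm : MeasurableSet B := MeasurableSet.of_mem_measurableCylinders hB
  have hlt : (ν + powerShift P g).real (A ∆ B) ≤ ε / 2 := ENNReal.toReal_le_of_le_ofReal
    (by positivity) hAB.le
  rw [measureReal_add_apply] at hlt
  have h1 := abs_measureReal_sub_le_measureReal_symmDiff (μ := ν) hA.nullMeasurableSet
    hBm.nullMeasurableSet
  have h2 := abs_measureReal_sub_le_measureReal_symmDiff (μ := powerShift P g)
    hA.nullMeasurableSet hBm.nullMeasurableSet
  have h3 : |(powerShift P g).real B - ν.real B| ≤ (|C| + 2) * K := by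
    obtain ⟨s, S, -, rfl⟩ := (mem_measurableCylinders B).1 hB
    obtain ⟨n, hn⟩ := s.exists_nat_subset_range
    have hcongr : powerShift P g (cylinder s S) = powerShift P (truncateSeq n g) (cylinder s S) := by
      refine powerShift_congr (n := n) (fun i hi => by simp [truncateSeq, hi]) hBm fun x y hxy => ?_
      have : s.restrict x = s.restrict y := by
        ext i
        exact hxy i (Finset.mem_range.1 (hn i.2))
      rw [mem_cylinder, mem_cylinder, this]
    rw [measureReal_def, hcongr, ← measureReal_def]
    refine hr.abs_powerShift_sub_le hC (n := n) (fun i hi => by simp [truncateSeq, hi]) hK ?_ hBm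
    refine le_of_eq_of_le (Finset.sum_congr rfl fun i hi => ?_) (hgK n)
    simp [truncateSeq, Finset.mem_range.1 hi]
  have h0 : 0 ≤ ν.real (A ∆ B) := measureReal_nonneg
  have h0' : 0 ≤ (powerShift P g).real (A ∆ B) := measureReal_nonneg
  rw [abs_le] at *
  constructor <;> linarith

/-- `t ↦ r (t * u) x` is differentiable near `0`, with the function and its derivative dominated by
a `P`-integrable function of `x`. -/
def HasDominatedDeriv (P : Measure ℝ) (r : ℝ → ℝ → ℝ) (u : ℝ) : Prop :=
  ∃ (W : ℝ → ℝ) (r' : ℝ → ℝ → ℝ), Measurable W ∧ Integrable W P ∧ Measurable (r' 0) ∧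
    ∀ t ∈ Metric.ball (0 : ℝ) 1, ∀ x,
      HasDerivAt (fun t => r (t * u) x) (r' t x) t ∧ |r' t x| ≤ W x ∧ r (t * u) x ≤ W x

lemma IsShiftDensity.hasDerivAt_powerShift (hr : IsShiftDensity P r)
    (hD : ∀ u, HasDominatedDeriv P r u) {n : ℕ} {g : ℕ → ℝ} (hg : ∀ i, n ≤ i → g i = 0)
    {A : Set (ℕ → ℝ)} (hA : MeasurableSet A) :
    ∃ l, HasDerivAt (fun t : ℝ => (powerShift P (t • g)).real A) l 0 := by
  choose W r' hWm hWi hr'm h using fun i => hD (g i)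
  set ν := Measure.infinitePi fun _ : ℕ => P
  let F : ℝ → (ℕ → ℝ) → ℝ := fun t x => ∏ i ∈ Finset.range n, r (t * g i) (x i)
  let F' : ℝ → (ℕ → ℝ) → ℝ := fun t x => ∑ i ∈ Finset.range n,
    (∏ j ∈ (Finset.range n).erase i, r (t * g j) (x j)) • r' i t (x i)
  let bound : (ℕ → ℝ) → ℝ := fun x => n * ∏ i ∈ Finset.range n, W i (x i)
  have hW0 : ∀ i y, 0 ≤ W i y := fun i y =>
    (abs_nonneg _).trans (h i 0 (Metric.mem_ball_self one_pos) y).2.1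
  have hFm : ∀ t, Measurable (F t) := fun t => Finset.measurable_prod _ fun i _ =>
    (hr.measurable (t * g i)).comp (measurable_pi_apply i)
  have hF'm : Measurable (F' 0) := by
    refine Finset.measurable_sum _ fun i _ => Measurable.mul ?_
      ((hr'm i).comp (measurable_pi_apply i))
    exact Finset.measurable_prod _ fun j _ => (hr.measurable (0 * g j)).comp (measurable_pi_apply j)
  have hbi : Integrable bound ν := (integrable_infinitePi_prod _ hWm hW0 hWi).const_mul _
  have key := hasDerivAt_integral_of_dominated_loc_of_deriv_le (μ := ν.restrict A) (F := F)
    (F' := F') (bound := bound) (x₀ := (0 : ℝ)) (Metric.ball_mem_nhds 0 one_pos)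
    (Eventually.of_forall fun t => (hFm t).aestronglyMeasurable)
    (hr.integrable_prod n fun i => 0 * g i).integrableOn
    hF'm.aestronglyMeasurable
    (ae_of_all _ fun x t ht => ?_) hbi.integrableOn (ae_of_all _ fun x t ht => ?_)
  · refine ⟨_, key.2.congr_of_eventuallyEq (Eventually.of_forall fun t => ?_)⟩
    exact hr.powerShift_real (g := t • g) (fun i hi => by simp [hg i hi]) hA
  · rw [Real.norm_eq_abs]
    refine (Finset.abs_sum_le_sum_abs _ _).trans ?_
    have : ∀ i ∈ Finset.range n,
        |(∏ j ∈ (Finset.range n).erase i, r (t * g j) (x j)) • r' i t (x i)|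
          ≤ ∏ i ∈ Finset.range n, W i (x i) := by
      intro i hi
      rw [smul_eq_mul, abs_mul,
        abs_of_nonneg (Finset.prod_nonneg fun j _ => hr.nonneg _ _),
        ← Finset.prod_erase_mul _ _ hi]
      refine mul_le_mul (Finset.prod_le_prod (fun j _ => hr.nonneg _ _) fun j _ =>
        (h j t ht (x j)).2.2) (h i t ht (x i)).2.1 (abs_nonneg _)
        (Finset.prod_nonneg fun j _ => hW0 _ _)
    refine (Finset.sum_le_sum this).trans ?_
    simp [bound]
  · exact HasDerivAt.fun_finsetProd fun i _ => (h i t ht (x i)).1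

lemma exists_sum_sq_sub_truncateSeq_le {g : ℕ → ℝ} (hg : Summable fun i => g i ^ 2) {ε : ℝ}
    (hε : 0 < ε) :
    ∃ n, ∀ m, ∑ i ∈ Finset.range m, (g i - truncateSeq n g i) ^ 2 ≤ ε := by
  obtain ⟨s, hs⟩ := summable_iff_vanishing_norm.1 hg ε hε
  obtain ⟨n, hn⟩ := s.exists_nat_subset_range
  refine ⟨n, fun m => ?_⟩
  have h1 : ∑ i ∈ Finset.range m, (g i - truncateSeq n g i) ^ 2
      = ∑ i ∈ (Finset.range m).filter (n ≤ ·), g i ^ 2 := by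
    rw [Finset.sum_filter]
    refine Finset.sum_congr rfl fun i _ => ?_
    by_cases hi : i < n
    · simp [truncateSeq, hi, not_le.2 hi]
    · simp [truncateSeq, hi, not_lt.1 hi]
  rw [h1]
  refine (le_abs_self _).trans (hs _ ?_).le
  rw [Finset.disjoint_left]
  intro i hi his
  have := Finset.mem_range.1 (hn his)
  exact absurd (Finset.mem_filter.1 hi).2 (not_le.2 this)

theorem IsShiftDensity.exists_tendsto_of_summable (hr : IsShiftDensity P r) {C : ℝ}
    (hC : ∀ u, 1 - C * u ^ 2 ≤ ∫ x, √(r u x) ∂P) (hD : ∀ u, HasDominatedDeriv P r u)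
    {g : ℕ → ℝ} (hg : Summable fun i => g i ^ 2) {A : Set (ℕ → ℝ)} (hA : MeasurableSet A) :
    ∃ l, Tendsto (fun t : ℝ => ((powerShift P (t • g)).real A
      - (Measure.infinitePi fun _ : ℕ => P).real A) / t) (𝓝[≠] 0) (𝓝 l) := by
  set ν := Measure.infinitePi fun _ : ℕ => P with hν
  rw [← cauchy_map_iff_exists_tendsto, Metric.cauchy_iff]
  refine ⟨inferInstance, fun ε hε => ?_⟩
  have hM : 0 < |C| + 2 := by positivity
  set K : ℝ := ε / (8 * (|C| + 2))
  have hK : 0 < K := by positivity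
  obtain ⟨n, hn⟩ := exists_sum_sq_sub_truncateSeq_le hg (ε := K ^ 2) (by positivity)
  obtain ⟨l, hl⟩ := hr.hasDerivAt_powerShift hD (g := truncateSeq n g)
    (fun i (hi : n ≤ i) => by simp [truncateSeq, hi]) hA
  rw [hasDerivAt_iff_tendsto_slope] at hl
  have hev := hl.eventually (Metric.ball_mem_nhds l (show 0 < ε / 8 by positivity))
  refine ⟨_, image_mem_map (inter_mem hev self_mem_nhdsWithin), ?_⟩
  have hmain : ∀ t ∈ {x | slope (fun t : ℝ => (powerShift P (t • truncateSeq n g)).real A) 0 x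
      ∈ Metric.ball l (ε / 8)} ∩ {0}ᶜ,
      |((powerShift P (t • g)).real A - ν.real A) / t - l| < ε / 4 := by
    rintro t ⟨ht, ht0⟩
    have ht0 : t ≠ 0 := ht0
    have ht' : |((powerShift P (t • truncateSeq n g)).real A - ν.real A) / t - l| < ε / 8 := by
      have : slope (fun t : ℝ => (powerShift P (t • truncateSeq n g)).real A) 0 t ∈
        Metric.ball l (ε / 8) := ht
      rwa [Metric.mem_ball, Real.dist_eq, slope_def_field, zero_smul, powerShift_zero, sub_zero]
        at this
    have hsplit : t • g = t • truncateSeq n g + t • (g - truncateSeq n g) := by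
      rw [← smul_add]; congr 1; abel
    have hm : MeasurableSet ((fun x : ℕ → ℝ => x - t • truncateSeq n g) ⁻¹' A) :=
      (show Measurable fun x : ℕ → ℝ => x - t • truncateSeq n g by fun_prop) hA
    have hb := hr.abs_powerShift_sub_le_of_forall_sum_le hC (g := t • (g - truncateSeq n g))
      (K := |t| * K) (by positivity) (fun m => ?_) hm
    · rw [measureReal_def, ← powerShift_add_apply _ _ hA, ← hsplit, ← measureReal_def,
        measureReal_def, measureReal_def, ← hν, ← powerShift_apply _ hA, ← measureReal_def,
        ← measureReal_def] at hb
      have hb' : |((powerShift P (t • g)).real A - (powerShift P (t • truncateSeq n g)).real A) / t|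
          ≤ ε / 8 := by
        rw [abs_div, div_le_iff₀ (abs_pos.2 ht0)]
        refine hb.trans_eq ?_
        simp only [K]
        field_simp
      have : ((powerShift P (t • g)).real A - ν.real A) / t - l =
        ((powerShift P (t • g)).real A - (powerShift P (t • truncateSeq n g)).real A) / t
        + (((powerShift P (t • truncateSeq n g)).real A - ν.real A) / t - l) := by ring
      rw [this]
      refine (abs_add_le _ _).trans_lt ?_
      linarith
    · have : ∀ i, (t • (g - truncateSeq n g)) i ^ 2 = t ^ 2 * (g i - truncateSeq n g i) ^ 2 := by
        intro i; simp [mul_pow]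
      simp_rw [this]
      rw [← Finset.mul_sum, mul_pow, sq_abs]
      gcongr
      exact hn m
  rintro _ ⟨t, ht, rfl⟩ _ ⟨t', ht', rfl⟩
  have h1 := hmain t ht
  have h2 := hmain t' ht'
  rw [Real.dist_eq, abs_lt]
  rw [abs_lt] at h1 h2
  constructor <;> linarith

lemma IsShiftDensity.exists_almost_separating (hr : IsShiftDensity P r) {c : ℝ} (hc : 0 < c)
    (hc' : ∀ u, ∫ x, √(r u x) ∂P ≤ 1 - c * min |u| 1 ^ 2) {g : ℕ → ℝ}
    (hg : ¬ Summable fun i => g i ^ 2) {ε : ℝ≥0∞} (hε : 0 < ε) :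
    ∃ A, MeasurableSet A ∧ (Measure.infinitePi fun _ : ℕ => P) Aᶜ ≤ ε ∧ powerShift P g A ≤ ε := by
  set ν := Measure.infinitePi fun _ : ℕ => P
  have ht := tendsto_prod_of_le_one_sub hc
    (fun _ => integral_nonneg fun _ => Real.sqrt_nonneg _) hc' hg
  have ht' := ENNReal.tendsto_ofReal ht
  rw [ENNReal.ofReal_zero] at ht'
  obtain ⟨n, hn⟩ := (ht'.eventually (gt_mem_nhds hε)).exists
  let F : (ℕ → ℝ) → ℝ := fun x => ∏ i ∈ Finset.range n, r (g i) (x i)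
  let G : (ℕ → ℝ) → ℝ≥0∞ := fun x => ∏ i ∈ Finset.range n, ENNReal.ofReal √(r (g i) (x i))
  have hF0 : ∀ x, 0 ≤ F x := fun x => Finset.prod_nonneg fun i _ => hr.nonneg _ _
  have hFm : Measurable F := Finset.measurable_prod _ fun i _ =>
    (hr.measurable (g i)).comp (measurable_pi_apply i)
  have hGF : ∀ x, G x = ENNReal.ofReal √(F x) := fun x => by
    simp only [G, F]
    rw [Real.sqrt_prod _ fun i _ => hr.nonneg _ _,
      ENNReal.ofReal_prod_of_nonneg fun i _ => Real.sqrt_nonneg _]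
  have hGint : ∫⁻ x, G x ∂ν ≤ ε := by
    refine le_trans (le_of_eq ?_) hn.le
    rw [lintegral_infinitePi_prod (Finset.range n) (f := fun i y => ENNReal.ofReal √(r (g i) y))
      (fun i => (hr.measurable (g i)).sqrt.ennreal_ofReal),
      ENNReal.ofReal_prod_of_nonneg fun i _ => integral_nonneg fun _ => Real.sqrt_nonneg _]
    exact Finset.prod_congr rfl fun i _ => (ofReal_integral_eq_lintegral_ofReal
      (hr.integrable_sqrt (g i)) (ae_of_all _ fun _ => Real.sqrt_nonneg _)).symm
  have hAm : MeasurableSet {x | F x ≤ 1} := hFm measurableSet_Iic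
  refine ⟨{x | F x ≤ 1}, hAm, ?_, ?_⟩
  · refine le_trans ?_ hGint
    rw [← lintegral_indicator_one hAm.compl]
    refine lintegral_mono fun x => ?_
    refine Set.indicator_le' (s := {x | F x ≤ 1}ᶜ) (g := G) (fun x hx => ?_) (fun _ _ => zero_le) x
    rw [hGF, Pi.one_apply, ENNReal.one_le_ofReal, Real.one_le_sqrt]
    exact (not_le.1 (show ¬ F x ≤ 1 from hx)).le
  · have hcongr : powerShift P g {x | F x ≤ 1} = powerShift P (truncateSeq n g) {x | F x ≤ 1} := by
      refine powerShift_congr (n := n) (fun i hi => by simp [truncateSeq, hi]) hAm fun x y hxy => ?_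
      have : F x = F y := Finset.prod_congr rfl fun i hi => by rw [hxy i (Finset.mem_range.1 hi)]
      rw [Set.mem_ofPred_eq, Set.mem_ofPred_eq, this]
    rw [hcongr, hr.powerShift_eq (n := n) (fun i hi => by simp [truncateSeq, hi]),
      withDensity_apply _ hAm]
    have hFt : ∀ x : ℕ → ℝ, ∏ i ∈ Finset.range n, r (truncateSeq n g i) (x i) = F x := fun x =>
      Finset.prod_congr rfl fun i hi => by simp [truncateSeq, Finset.mem_range.1 hi]
    simp_rw [hFt]
    refine le_trans (setLIntegral_mono' hAm fun x hx => ?_)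
      ((setLIntegral_le_lintegral {x | F x ≤ 1} G).trans hGint)
    rw [hGF]
    refine ENNReal.ofReal_le_ofReal (Real.le_sqrt_of_sq_le ?_)
    have : F x ≤ 1 := hx
    nlinarith [hF0 x]

theorem IsShiftDensity.summable_of_tendsto (hr : IsShiftDensity P r) {c : ℝ} (hc : 0 < c)
    (hc' : ∀ u, ∫ x, √(r u x) ∂P ≤ 1 - c * min |u| 1 ^ 2) {g : ℕ → ℝ}
    (h : ∀ A : Set (ℕ → ℝ), MeasurableSet A → Tendsto (fun t : ℝ => (powerShift P (t • g)).real A)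
      (𝓝[≠] 0) (𝓝 ((Measure.infinitePi fun _ : ℕ => P).real A))) :
    Summable fun i => g i ^ 2 := by
  set ν := Measure.infinitePi fun _ : ℕ => P
  by_contra hg
  let t : ℕ → ℝ := fun k => 1 / ((k : ℝ) + 1)
  have ht0 : ∀ k, t k ≠ 0 := fun k => by positivity
  have ht : Tendsto t atTop (𝓝[≠] 0) := tendsto_nhdsWithin_iff.2
    ⟨tendsto_one_div_add_atTop_nhds_zero_nat, Eventually.of_forall ht0⟩
  have hgt : ∀ k, ¬ Summable fun i => (t k • g) i ^ 2 := by
    intro k hs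
    apply hg
    simp only [Pi.smul_apply, smul_eq_mul, mul_pow] at hs
    exact (summable_mul_left_iff (pow_ne_zero 2 (ht0 k))).1 hs
  obtain ⟨δ, hδ0, hδ⟩ := ENNReal.exists_pos_sum_of_countable' (ε := 1 / 4) (by simp) ℕ
  choose A hAm hA1 hA2 using fun k => hr.exists_almost_separating hc hc' (hgt k) (hδ0 k)
  have hBm : MeasurableSet (⋂ k, A k) := MeasurableSet.iInter hAm
  have hB1 : ν (⋂ k, A k)ᶜ ≤ 1 / 4 := by
    rw [Set.compl_iInter]
    exact (measure_iUnion_le _).trans ((ENNReal.tsum_le_tsum hA1).trans hδ.le)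
  have hB1' : 3 / 4 ≤ ν.real (⋂ k, A k) := by
    have h1 : ν.real (⋂ k, A k)ᶜ ≤ 1 / 4 := by
      have := ENNReal.toReal_mono (by simp) hB1
      simpa [measureReal_def] using this
    rw [probReal_compl_eq_one_sub hBm] at h1
    linarith
  have hB2 : ∀ k, (powerShift P (t k • g)).real (⋂ k, A k) ≤ 1 / 4 := by
    intro k
    have h1 : powerShift P (t k • g) (⋂ k, A k) ≤ 1 / 4 :=
      (measure_mono (Set.iInter_subset A k)).trans
        ((hA2 k).trans ((ENNReal.le_tsum k).trans hδ.le))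
    have := ENNReal.toReal_mono (by simp) h1
    simpa [measureReal_def] using this
  have := le_of_tendsto ((h _ hBm).comp ht) (Eventually.of_forall hB2)
  linarith

end Product

section ExpPower

variable {p : ℝ}

lemma exists_exp_neg_rpow_mul_le (hp : 1 < p) :
    ∃ K, 0 < K ∧ ∀ y : ℝ,
      Real.exp (-|y| ^ p / 2) * (1 + p * |y| ^ (p - 1)) ≤ K * Real.exp (-|y|) := by
  set a := p - 1 with ha
  have ha0 : 0 < a := by linarith
  set M : ℝ := 6 ^ (1 / a) with hM
  have hM0 : 0 < M := by positivity
  refine ⟨Real.exp (3 * M) * (1 + p * a ^ a), by positivity, fun y => ?_⟩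
  generalize hz : |y| = z
  have hz0 : 0 ≤ z := hz ▸ abs_nonneg y
  have h1 : -z ^ p / 2 ≤ 3 * M - 2 * z - z := by
    rcases le_total z M with h | h
    · have : 0 ≤ z ^ p := by positivity
      linarith
    · have h6 : 6 ≤ z ^ a := by
        calc (6 : ℝ) = M ^ a := by
              rw [hM, ← Real.rpow_mul (by norm_num), one_div_mul_cancel ha0.ne', Real.rpow_one]
          _ ≤ z ^ a := by gcongr
      have hzp : z ^ p = z ^ a * z := by
        rw [show p = a + 1 by ring, Real.rpow_add_one' hz0 (by linarith)]
      nlinarith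
  have h2 : z ^ a ≤ a ^ a * Real.exp z := by
    have h3 : z / a ≤ Real.exp (z / a) := by linarith [Real.add_one_le_exp (z / a)]
    have h4 : (z / a) ^ a ≤ Real.exp (z / a) ^ a := by gcongr
    rw [← Real.exp_mul, div_mul_cancel₀ _ ha0.ne', Real.div_rpow hz0 ha0.le,
      div_le_iff₀ (by positivity)] at h4
    linarith
  have h5 : 1 + p * z ^ a ≤ (1 + p * a ^ a) * Real.exp z := by
    have : 1 ≤ Real.exp z := Real.one_le_exp hz0
    nlinarith
  calc Real.exp (-z ^ p / 2) * (1 + p * z ^ a)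
      ≤ Real.exp (3 * M - 2 * z - z) * ((1 + p * a ^ a) * Real.exp z) := by gcongr
    _ = Real.exp (3 * M) * (1 + p * a ^ a) * Real.exp (-2 * z) := by
        rw [show 3 * M - 2 * z - z = 3 * M + (-2 * z) + (-z) by ring, Real.exp_add, Real.exp_add,
          Real.exp_neg z]
        field_simp
    _ ≤ Real.exp (3 * M) * (1 + p * a ^ a) * Real.exp (-z) := by
        gcongr
        linarith

/-- The ratio of the density `exp (-|x| ^ p)` at `x + u` and at `x`. -/
noncomputable def expPowRatio (p u x : ℝ) : ℝ := Real.exp (|x| ^ p - |x + u| ^ p)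

/-- The measure on `ℝ` with density `σ * exp (-|x| ^ p)`. -/
noncomputable def expPowMeasure (σ p : ℝ) : Measure ℝ :=
  volume.withDensity fun x => ENNReal.ofReal (σ * Real.exp (-|x| ^ p))

lemma isShiftDensity_expPowRatio {σ : ℝ} (hσ : 0 ≤ σ) :
    IsShiftDensity (expPowMeasure σ p) (expPowRatio p) where
  measurable u := by unfold expPowRatio; fun_prop
  nonneg u x := (Real.exp_pos _).le
  zero x := by simp [expPowRatio]
  map_sub u := by
    have hm : Measurable fun x : ℝ => ENNReal.ofReal (σ * Real.exp (-|x| ^ p)) := by fun_prop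
    have hm' : Measurable fun x : ℝ => ENNReal.ofReal (expPowRatio p u x) := by
      unfold expPowRatio; fun_prop
    ext B hB
    have hs : Measurable fun x : ℝ => x - u := by fun_prop
    rw [expPowMeasure, ← withDensity_mul _ hm hm', Measure.map_apply hs hB,
      withDensity_apply _ (hs hB), withDensity_apply _ hB, ← lintegral_indicator (hs hB),
      ← lintegral_indicator hB, ← lintegral_add_right_eq_self _ u]
    refine lintegral_congr fun x => ?_
    by_cases hx : x ∈ B
    · rw [Set.indicator_of_mem hx, Set.indicator_of_mem (by simpa using hx), Pi.mul_apply,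
        ← ENNReal.ofReal_mul (by positivity), expPowRatio, mul_assoc, ← Real.exp_add]
      congr 3
      ring
    · rw [Set.indicator_of_notMem hx, Set.indicator_of_notMem (by simpa using hx)]

lemma integrable_exp_rpow_sub_abs {σ : ℝ} (hσ : 0 ≤ σ) :
    Integrable (fun x : ℝ => Real.exp (|x| ^ p - |x|)) (expPowMeasure σ p) := by
  have hm : Measurable fun x : ℝ => ENNReal.ofReal (σ * Real.exp (-|x| ^ p)) := by fun_prop
  rw [expPowMeasure, integrable_withDensity_iff_integrable_smul' hm
    (ae_of_all _ fun _ => ENNReal.ofReal_lt_top)]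
  have h1 : Integrable fun x : ℝ => Real.exp (-|x|) := by
    refine (integrable_inv_one_add_sq.const_mul 2).mono' (by fun_prop) (ae_of_all _ fun x => ?_)
    have hq := Real.quadratic_le_exp_of_nonneg (abs_nonneg x)
    rw [sq_abs] at hq
    rw [Real.norm_of_nonneg (Real.exp_pos _).le, Real.exp_neg, ← div_eq_mul_inv,
      inv_le_comm₀ (Real.exp_pos _) (by positivity), inv_div]
    linarith [abs_nonneg x]
  refine (h1.const_mul σ).congr (ae_of_all _ fun x => ?_)
  simp only
  rw [ENNReal.toReal_ofReal (by positivity), smul_eq_mul, mul_assoc, ← Real.exp_add]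
  congr 2
  ring

lemma abs_rpow_sub_two_mul (hp : 1 < p) (y : ℝ) : |p * |y| ^ (p - 2) * y| = p * |y| ^ (p - 1) := by
  rw [abs_mul, abs_mul, abs_of_pos (by linarith : 0 < p),
    abs_of_nonneg (Real.rpow_nonneg (abs_nonneg y) _), mul_assoc,
    ← Real.rpow_add_one' (abs_nonneg y) (by linarith)]
  congr 2
  ring

lemma hasDominatedDeriv_expPowRatio (hp : 1 < p) {σ : ℝ} (hσ : 0 ≤ σ) (u : ℝ) :
    HasDominatedDeriv (expPowMeasure σ p) (expPowRatio p) u := by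
  obtain ⟨K, hK, hKle⟩ := exists_exp_neg_rpow_mul_le hp
  refine ⟨fun x => ((1 + |u|) * K * Real.exp |u|) * Real.exp (|x| ^ p - |x|),
    fun t x => expPowRatio p (t * u) x * -(p * |x + t * u| ^ (p - 2) * (x + t * u) * u),
    by fun_prop, (integrable_exp_rpow_sub_abs hσ).const_mul _, ?_, fun t ht x => ?_⟩
  · unfold expPowRatio; fun_prop
  have hd : HasDerivAt (fun t : ℝ => x + t * u) u t := by
    simpa using ((hasDerivAt_id t).mul_const u).const_add x
  have hd2 := (((hasDerivAt_abs_rpow (x + t * u) hp).comp t hd).const_sub (|x| ^ p)).exp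
  have habs : |x| - |u| ≤ |x + t * u| := by
    have h1 : |t * u| ≤ |u| := by
      rw [abs_mul]
      have : |t| < 1 := by simpa using ht
      nlinarith [abs_nonneg u]
    have h2 := abs_sub_abs_le_abs_sub x (-(t * u))
    rw [abs_neg, sub_neg_eq_add] at h2
    linarith
  have hmain : expPowRatio p (t * u) x * (1 + p * |x + t * u| ^ (p - 1))
      ≤ K * Real.exp |u| * Real.exp (|x| ^ p - |x|) := by
    set y := x + t * u
    have h3 : Real.exp (-|y| ^ p) ≤ Real.exp (-|y| ^ p / 2) := by
      have : 0 ≤ |y| ^ p := by positivity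
      gcongr
      linarith
    calc expPowRatio p (t * u) x * (1 + p * |y| ^ (p - 1))
        = Real.exp (|x| ^ p) * (Real.exp (-|y| ^ p) * (1 + p * |y| ^ (p - 1))) := by
          rw [expPowRatio, sub_eq_add_neg, Real.exp_add, mul_assoc]
      _ ≤ Real.exp (|x| ^ p) * (Real.exp (-|y| ^ p / 2) * (1 + p * |y| ^ (p - 1))) := by gcongr
      _ ≤ Real.exp (|x| ^ p) * (K * Real.exp (-|y|)) := by
          exact mul_le_mul_of_nonneg_left (hKle y) (Real.exp_pos _).le
      _ ≤ Real.exp (|x| ^ p) * (K * Real.exp (|u| - |x|)) := by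
          gcongr
          linarith
      _ = K * Real.exp |u| * Real.exp (|x| ^ p - |x|) := by
          rw [Real.exp_sub, Real.exp_sub]; ring
  have hr0 : 0 ≤ expPowRatio p (t * u) x := (Real.exp_pos _).le
  have hB0 : 0 ≤ K * Real.exp |u| * Real.exp (|x| ^ p - |x|) := by positivity
  have hy0 : 0 ≤ p * |x + t * u| ^ (p - 1) := by positivity
  refine ⟨hd2, ?_, ?_⟩
  · rw [abs_mul, abs_neg, abs_mul, abs_rpow_sub_two_mul hp, abs_of_nonneg hr0]
    calc _ = |u| * (expPowRatio p (t * u) x * (p * |x + t * u| ^ (p - 1))) := by ring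
      _ ≤ |u| * (K * Real.exp |u| * Real.exp (|x| ^ p - |x|)) := by
          exact mul_le_mul_of_nonneg_left (by nlinarith) (abs_nonneg u)
      _ ≤ _ := by nlinarith
  · have := abs_nonneg u
    nlinarith [mul_nonneg hr0 hy0, mul_nonneg this hB0]

section Affinity

variable {σ : ℝ} [IsProbabilityMeasure (expPowMeasure σ p)]

lemma IsShiftDensity.integral_sqrt_sub_one_sq {P : Measure ℝ} [IsProbabilityMeasure P]
    {r : ℝ → ℝ → ℝ} (hr : IsShiftDensity P r) (u : ℝ) :
    Integrable (fun x => (√(r u x) - 1) ^ 2) P ∧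
      ∫ x, (√(r u x) - 1) ^ 2 ∂P = 2 - 2 * ∫ x, √(r u x) ∂P := by
  have h : ∀ x, (√(r u x) - 1) ^ 2 = r u x + 1 - 2 * √(r u x) := fun x => by
    rw [sub_sq, Real.sq_sqrt (hr.nonneg u x)]; ring
  simp_rw [h]
  have h1 : Integrable (fun x => r u x + 1) P := (hr.integrable u).add (integrable_const 1)
  refine ⟨h1.sub ((hr.integrable_sqrt u).const_mul 2), ?_⟩
  rw [integral_sub h1 ((hr.integrable_sqrt u).const_mul 2),
    integral_add (hr.integrable u) (integrable_const 1), hr.integral_eq_one, integral_const_mul]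
  simp
  norm_num

lemma sqrt_expPowRatio (u x : ℝ) :
    √(expPowRatio p u x) = Real.exp (|x| ^ p / 2) * Real.exp (-|x + u| ^ p / 2) := by
  rw [expPowRatio, Real.sqrt_eq_iff_mul_self_eq (Real.exp_pos _).le (by positivity),
    ← Real.exp_add, ← Real.exp_add]
  congr 1
  ring

lemma exists_one_sub_le_integral_sqrt_expPowRatio (hp : 1 < p) (hσ : 0 ≤ σ) :
    ∃ C, ∀ u, 1 - C * u ^ 2 ≤ ∫ x, √(expPowRatio p u x) ∂(expPowMeasure σ p) := by
  obtain ⟨K, hK, hKle⟩ := exists_exp_neg_rpow_mul_le hp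
  set P := expPowMeasure σ p
  have hr := isShiftDensity_expPowRatio (p := p) hσ
  set L := ∫ x : ℝ, Real.exp (|x| ^ p - |x|) ∂P
  have hL : 0 ≤ L := integral_nonneg fun _ => (Real.exp_pos _).le
  refine ⟨1 + (K * Real.exp 1) ^ 2 * L, fun u => ?_⟩
  rcases lt_or_ge 1 |u| with hu | hu
  · have h1 : 1 ≤ u ^ 2 := by rw [← sq_abs]; nlinarith
    have h2 : 0 ≤ ∫ x, √(expPowRatio p u x) ∂P := integral_nonneg fun _ => Real.sqrt_nonneg _
    have h3 : 0 ≤ (K * Real.exp 1) ^ 2 * L := by positivity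
    nlinarith
  obtain ⟨hi, he⟩ := hr.integral_sqrt_sub_one_sq u
  have hpt : ∀ x, (√(expPowRatio p u x) - 1) ^ 2
      ≤ u ^ 2 * (K * Real.exp 1) ^ 2 * Real.exp (|x| ^ p - |x|) := by
    intro x
    have hmv : ‖Real.exp (-|x + u| ^ p / 2) - Real.exp (-|x| ^ p / 2)‖
        ≤ (K * Real.exp (1 - |x|)) * ‖(x + u) - x‖ := by
      refine Convex.norm_image_sub_le_of_norm_hasDerivWithin_le
        (f := fun y : ℝ => Real.exp (-|y| ^ p / 2))
        (f' := fun y => Real.exp (-|y| ^ p / 2) * (-(p * |y| ^ (p - 2) * y) / 2))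
        (s := Metric.closedBall x 1) (fun y _ => ?_) (fun y hy => ?_)
        (convex_closedBall x 1) (Metric.mem_closedBall_self zero_le_one) (by simpa using hu)
      · exact (((hasDerivAt_abs_rpow y hp).neg.div_const 2).exp).hasDerivWithinAt
      · rw [Real.norm_eq_abs, abs_mul, abs_div, abs_neg, abs_rpow_sub_two_mul hp, abs_two,
          abs_of_pos (Real.exp_pos _)]
        have hy' : |y - x| ≤ 1 := by simpa [Real.dist_eq] using hy
        have h4 : |x| - 1 ≤ |y| := by
          have := abs_sub_abs_le_abs_sub x y
          rw [abs_sub_comm] at this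
          linarith
        have h5 : 0 ≤ p * |y| ^ (p - 1) := by positivity
        calc _ ≤ Real.exp (-|y| ^ p / 2) * (1 + p * |y| ^ (p - 1)) := by
              gcongr
              linarith
          _ ≤ K * Real.exp (-|y|) := hKle y
          _ ≤ K * Real.exp (1 - |x|) := by
              gcongr
              linarith
    rw [add_sub_cancel_left, Real.norm_eq_abs, Real.norm_eq_abs] at hmv
    have hfac : √(expPowRatio p u x) - 1 = Real.exp (|x| ^ p / 2) *
        (Real.exp (-|x + u| ^ p / 2) - Real.exp (-|x| ^ p / 2)) := by
      rw [sqrt_expPowRatio, mul_sub, ← Real.exp_add (|x| ^ p / 2) (-|x| ^ p / 2),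
        show |x| ^ p / 2 + -|x| ^ p / 2 = 0 by ring, Real.exp_zero]
    rw [hfac, mul_pow, ← sq_abs (Real.exp (-|x + u| ^ p / 2) - _)]
    calc _ ≤ Real.exp (|x| ^ p / 2) ^ 2 * (K * Real.exp (1 - |x|) * |u|) ^ 2 := by gcongr
      _ = u ^ 2 * (K * Real.exp 1) ^ 2 * Real.exp (|x| ^ p - |x| - |x|) := by
          rw [mul_pow, mul_pow, sq_abs, mul_pow, ← Real.exp_nat_mul, ← Real.exp_nat_mul,
            ← Real.exp_nat_mul, show |x| ^ p - |x| - |x| = 2 * (|x| ^ p / 2) + 2 * (1 - |x|) - 2 * 1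
              by ring, Real.exp_sub, Real.exp_add]
          push_cast
          field_simp
      _ ≤ _ := by
          gcongr
          linarith [abs_nonneg x]
  have hle := integral_mono hi ((integrable_exp_rpow_sub_abs hσ).const_mul _) hpt
  rw [he, integral_const_mul] at hle
  change _ ≤ _ * L at hle
  nlinarith [sq_nonneg u, mul_nonneg (sq_nonneg u) (mul_nonneg (sq_nonneg (K * Real.exp 1)) hL)]

lemma rpow_add_ge (hp : 1 < p) {y v w : ℝ} (hy : 1 ≤ y) (hv : 0 ≤ v) (hvw : v ≤ w) :
    y ^ p + v ≤ (y + w) ^ p := by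
  have h1 : (y + v) ^ p ≤ (y + w) ^ p := by gcongr
  have h2 : (y + v) ^ p = (y + v) ^ (p - 1) * (y + v) := by
    rw [← Real.rpow_add_one' (by linarith) (by linarith)]; ring_nf
  have h3 : y ^ p = y ^ (p - 1) * y := by
    rw [← Real.rpow_add_one' (by linarith) (by linarith)]; ring_nf
  have h4 : y ^ (p - 1) ≤ (y + v) ^ (p - 1) := by
    gcongr
    linarith
  have h5 : 1 ≤ y ^ (p - 1) := Real.one_le_rpow hy (by linarith)
  nlinarith

lemma min_sq_mul_le_integral_sqrt (hσ : 0 ≤ σ) {u : ℝ} {S : Set ℝ} (hS : MeasurableSet S)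
    (h : ∀ x ∈ S, |x| ^ p + min |u| 1 ≤ |x + u| ^ p) :
    ∫ x, √(expPowRatio p u x) ∂(expPowMeasure σ p)
      ≤ 1 - (expPowMeasure σ p).real S / 32 * min |u| 1 ^ 2 := by
  set P := expPowMeasure σ p
  have hr := isShiftDensity_expPowRatio (p := p) hσ
  obtain ⟨hi, he⟩ := hr.integral_sqrt_sub_one_sq u
  set v := min |u| 1
  have hv0 : 0 ≤ v := by positivity
  have hv1 : v ≤ 1 := min_le_right _ _
  have h1 : ∀ x ∈ S, (v / 4) ^ 2 ≤ (√(expPowRatio p u x) - 1) ^ 2 := by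
    intro x hx
    have h2 : √(expPowRatio p u x) ≤ 1 - v / 4 := by
      rw [sqrt_expPowRatio, ← Real.exp_add]
      calc _ ≤ Real.exp (-(v / 2)) := by
            gcongr
            linarith [h x hx]
        _ ≤ 1 - v / 4 := by
            have h3 := Real.add_one_le_exp (v / 2)
            rw [Real.exp_neg, inv_le_comm₀ (Real.exp_pos _) (by linarith)]
            refine le_trans ?_ h3
            rw [inv_le_iff_one_le_mul₀ (by linarith)]
            nlinarith
    rw [← neg_sq (√(expPowRatio p u x) - 1)]
    gcongr
    linarith
  have h2 : P.real S * (v / 4) ^ 2 ≤ ∫ x, (√(expPowRatio p u x) - 1) ^ 2 ∂P := by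
    calc P.real S * (v / 4) ^ 2 = ∫ _ in S, (v / 4) ^ 2 ∂P := by simp
      _ ≤ ∫ x in S, (√(expPowRatio p u x) - 1) ^ 2 ∂P :=
          setIntegral_mono_on (integrable_const _) hi.integrableOn hS h1
      _ ≤ _ := setIntegral_le_integral hi (ae_of_all _ fun _ => sq_nonneg _)
  rw [he] at h2
  nlinarith

lemma expPowMeasure_real_pos (hσ : 0 < σ) {a b : ℝ} (hab : a < b) :
    0 < (expPowMeasure σ p).real (Set.Icc a b) := by
  have hac : volume ≪ expPowMeasure σ p :=
    withDensity_absolutelyContinuous' (by fun_prop) (ae_of_all _ fun x => by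
      have : 0 < σ * Real.exp (-|x| ^ p) := by positivity
      simpa using this)
  refine ENNReal.toReal_pos (fun h0 => ?_) (measure_ne_top _ _)
  have := hac h0
  rw [Real.volume_Icc, ENNReal.ofReal_eq_zero] at this
  linarith

lemma exists_integral_sqrt_expPowRatio_le (hp : 1 < p) (hσ : 0 < σ) :
    ∃ c, 0 < c ∧ ∀ u, ∫ x, √(expPowRatio p u x) ∂(expPowMeasure σ p) ≤ 1 - c * min |u| 1 ^ 2 := by
  have h1 := expPowMeasure_real_pos (p := p) hσ (show (1 : ℝ) < 2 by norm_num)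
  have h2 := expPowMeasure_real_pos (p := p) hσ (show (-2 : ℝ) < -1 by norm_num)
  set m1 := (expPowMeasure σ p).real (Set.Icc 1 2)
  set m2 := (expPowMeasure σ p).real (Set.Icc (-2) (-1))
  refine ⟨min m1 m2 / 32, by positivity, fun u => ?_⟩
  have hv0 : 0 ≤ min |u| 1 := by positivity
  rcases le_total 0 u with hu | hu
  · refine (min_sq_mul_le_integral_sqrt hσ.le measurableSet_Icc (S := Set.Icc 1 2)
      fun x hx => ?_).trans ?_
    · rw [abs_of_nonneg (by linarith [hx.1] : 0 ≤ x), abs_of_nonneg (by linarith [hx.1] : 0 ≤ x + u)]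
      exact rpow_add_ge hp hx.1 hv0 ((min_le_left _ _).trans (abs_of_nonneg hu).le)
    · gcongr
      exact min_le_left _ _
  · refine (min_sq_mul_le_integral_sqrt hσ.le measurableSet_Icc (S := Set.Icc (-2) (-1))
      fun x hx => ?_).trans ?_
    · rw [abs_of_nonpos (by linarith [hx.2] : x ≤ 0), abs_of_nonpos (by linarith [hx.2] : x + u ≤ 0),
        neg_add]
      exact rpow_add_ge hp (by linarith [hx.2]) hv0 ((min_le_left _ _).trans (abs_of_nonpos hu).le)
    · gcongr
      exact min_le_right _ _

end Affinity

end ExpPower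

lemma eq_infinitePi_of_forall_range {μ : Measure (ℕ → ℝ)} {ρ : ℕ → Measure ℝ}
    [∀ i, IsProbabilityMeasure (ρ i)]
    (hprod : ∀ (n : ℕ) (A : ℕ → Set ℝ), (∀ i, MeasurableSet (A i)) →
      μ {x : ℕ → ℝ | ∀ i < n, x i ∈ A i} = ∏ i ∈ Finset.range n, ρ i (A i)) :
    μ = Measure.infinitePi ρ := by
  refine Measure.eq_infinitePi _ fun s t ht => ?_
  obtain ⟨n, hn⟩ := s.exists_nat_subset_range
  have hset : Set.pi (s : Set ℕ) t
      = {x : ℕ → ℝ | ∀ i < n, x i ∈ if i ∈ s then t i else Set.univ} := by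
    ext x
    refine ⟨fun hx i _ => ?_, fun hx i hi => ?_⟩
    · split_ifs with hi
      exacts [hx i hi, trivial]
    · have := hx i (Finset.mem_range.1 (hn hi))
      rwa [if_pos (Finset.mem_coe.1 hi)] at this
  rw [hset, hprod n (fun i => if i ∈ s then t i else Set.univ) fun i => by
    split_ifs
    exacts [ht i, .univ], ← Finset.prod_subset hn]
  · exact Finset.prod_congr rfl fun i hi => by rw [if_pos hi]
  · intro i _ hi
    rw [if_neg hi, measure_univ]

lemma map_image_add_smul {P : Measure ℝ} {a h g : ℕ → ℝ} (hag : ∀ i, a i * g i = h i) (t : ℝ)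
    {A : Set (ℕ → ℝ)} (hA : MeasurableSet A) :
    (Measure.infinitePi fun _ : ℕ => P).map (fun x i => a i * x i) ((· + t • h) '' A)
      = powerShift P (t • g) ((fun x i => a i * x i) ⁻¹' A) := by
  have hS : Measurable fun (x : ℕ → ℝ) i => a i * x i := by fun_prop
  have hsub : Measurable fun x : ℕ → ℝ => x + -(t • h) := by fun_prop
  rw [Set.image_add_right, Measure.map_apply hS (hsub hA), powerShift_apply _ (hS hA),
    ← Set.preimage_comp, ← Set.preimage_comp]
  congr 2
  ext x i
  simp only [Function.comp_apply, Pi.add_apply, Pi.neg_apply, Pi.smul_apply, Pi.sub_apply,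
    smul_eq_mul, ← hag i]
  ring

lemma tendsto_of_tendsto_sub_div {f : ℝ → ℝ} {c l : ℝ}
    (h : Tendsto (fun t => (f t - c) / t) (𝓝[≠] 0) (𝓝 l)) : Tendsto f (𝓝[≠] 0) (𝓝 c) := by
  have h0 : Tendsto (fun t : ℝ => t) (𝓝[≠] 0) (𝓝 0) := tendsto_id.mono_left nhdsWithin_le_nhds
  have h1 := (h.mul h0).add_const c
  rw [mul_zero, zero_add] at h1
  refine h1.congr' (eventually_mem_nhdsWithin.mono fun t ht => ?_)
  rw [div_mul_cancel₀ _ ht, sub_add_cancel]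

/-- Theorem 5.3: the Besov `B^s_p` prior (as a product measure on sequence space) is
Fomin differentiable along `h` iff `Σ ℓ^{2s/d + 1 − 2/p} h_ℓ² < ∞`.
Coordinates are indexed by `ℓ : ℕ`, with `ℓ + 1` playing the role of `ℓ ≥ 1`. -/
theorem stmt13 (p : ℝ) (hp : 1 < p) (d : ℕ) (hd : 0 < d) (s : ℝ)
    (σp : ℝ) (hσ : σp = (∫ x : ℝ, Real.exp (-|x| ^ p))⁻¹)
    (ρ : ℕ → Measure ℝ)
    (hρ : ∀ ℓ : ℕ, ρ ℓ
      = Measure.map (fun x : ℝ => ((ℓ : ℝ) + 1) ^ (-s/(d:ℝ) - 1/2 + 1/p) * x)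
          (MeasureTheory.volume.withDensity
            (fun x => ENNReal.ofReal (σp * Real.exp (-|x| ^ p)))))
    (lam : Measure (ℕ → ℝ)) [IsProbabilityMeasure lam]
    (hprod : ∀ (n : ℕ) (A : ℕ → Set ℝ), (∀ i, MeasurableSet (A i)) →
      lam {x : ℕ → ℝ | ∀ i < n, x i ∈ A i} = ∏ i ∈ Finset.range n, ρ i (A i))
    (h : ℕ → ℝ) :
    (∀ A : Set (ℕ → ℝ), MeasurableSet A → ∃ l : ℝ,
        Tendsto (fun t : ℝ => ((lam ((· + t • h) '' A)).toReal - (lam A).toReal) / t)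
          (𝓝[≠] 0) (𝓝 l))
      ↔ Summable (fun ℓ : ℕ => ((ℓ : ℝ) + 1) ^ (2*s/(d:ℝ) + 1 - 2/p) * (h ℓ) ^ 2) := by
  set a : ℕ → ℝ := fun ℓ => ((ℓ : ℝ) + 1) ^ (-s/(d:ℝ) - 1/2 + 1/p) with ha
  have ha0 : ∀ ℓ, 0 < a ℓ := fun ℓ => by positivity
  have hρ' : ∀ ℓ, ρ ℓ = (expPowMeasure σp p).map fun x => a ℓ * x := hρ
  have hmul : ∀ ℓ, Measurable fun x : ℝ => a ℓ * x := fun ℓ => by fun_prop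
  have hP : IsProbabilityMeasure (expPowMeasure σp p) := by
    refine ⟨?_⟩
    have h1 := hprod 1 (fun _ => Set.univ) fun _ => .univ
    simpa [hρ', Measure.map_apply (hmul 0) .univ] using h1.symm
  have hσ0 : 0 < σp := by
    by_contra! hle
    have h1 : expPowMeasure σp p Set.univ = 0 := by
      rw [expPowMeasure, withDensity_apply _ .univ]
      simp [ENNReal.ofReal_of_nonpos (mul_nonpos_of_nonpos_of_nonneg hle (Real.exp_pos _).le)]
    simp at h1
  have hρprob : ∀ ℓ, IsProbabilityMeasure (ρ ℓ) := fun ℓ => by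
    rw [hρ']
    exact Measure.isProbabilityMeasure_map (hmul ℓ).aemeasurable
  set ν := Measure.infinitePi fun _ : ℕ => expPowMeasure σp p with hν
  have hlam : lam = ν.map fun x i => a i * x i := by
    have := fun ℓ => Measure.isProbabilityMeasure_map (μ := expPowMeasure σp p)
      (hmul ℓ).aemeasurable
    rw [eq_infinitePi_of_forall_range hprod, hν,
      Measure.infinitePi_map_pi (fun _ : ℕ => expPowMeasure σp p) hmul]
    congr 1
    exact funext hρ'
  set g : ℕ → ℝ := fun ℓ => h ℓ / a ℓ with hg
  have hag : ∀ ℓ, a ℓ * g ℓ = h ℓ := fun ℓ => mul_div_cancel₀ _ (ha0 ℓ).ne'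
  have hS : Measurable fun (x : ℕ → ℝ) i => a i * x i := by fun_prop
  have hquot : ∀ A : Set (ℕ → ℝ), MeasurableSet A → ∀ t : ℝ,
      ((lam ((· + t • h) '' A)).toReal - (lam A).toReal) / t
        = ((powerShift (expPowMeasure σp p) (t • g)).real ((fun x i => a i * x i) ⁻¹' A)
          - ν.real ((fun x i => a i * x i) ⁻¹' A)) / t := fun A hA t => by
    rw [hlam, map_image_add_smul hag t hA, Measure.map_apply hS hA, measureReal_def,
      measureReal_def]
  have hsq : (fun ℓ : ℕ => ((ℓ : ℝ) + 1) ^ (2*s/(d:ℝ) + 1 - 2/p) * (h ℓ) ^ 2)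
      = fun ℓ => g ℓ ^ 2 := by
    ext ℓ
    have hb : 0 ≤ (ℓ : ℝ) + 1 := by positivity
    rw [hg, ha, div_pow, ← Real.rpow_natCast (((ℓ : ℝ) + 1) ^ _) 2, ← Real.rpow_mul hb,
      div_eq_mul_inv (_ ^ 2), ← Real.rpow_neg hb, mul_comm]
    congr 2
    push_cast
    ring
  have hr := isShiftDensity_expPowRatio (p := p) hσ0.le
  rw [hsq]
  refine ⟨fun hdiff => ?_, fun hsum A hA => ?_⟩
  · obtain ⟨c, hc, hc'⟩ := exists_integral_sqrt_expPowRatio_le hp hσ0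
    refine hr.summable_of_tendsto hc hc' fun A hA => ?_
    have hdiv : Measurable fun (x : ℕ → ℝ) i => x i / a i := by fun_prop
    obtain ⟨l, hl⟩ := hdiff _ (hdiv hA)
    have hpre : (fun (x : ℕ → ℝ) i => a i * x i) ⁻¹' ((fun (x : ℕ → ℝ) i => x i / a i) ⁻¹' A)
        = A := by
      ext x
      simp only [Set.mem_preimage, mul_div_cancel_left₀ _ (ha0 _).ne']
    simp_rw [hquot _ (hdiv hA), hpre] at hl
    exact tendsto_of_tendsto_sub_div hl
  · obtain ⟨C, hC⟩ := exists_one_sub_le_integral_sqrt_expPowRatio hp hσ0.le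
    simp_rw [hquot A hA]
    exact hr.exists_tendsto_of_summable hC (hasDominatedDeriv_expPowRatio hp hσ0.le) hsum (hS hA)
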